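/- For α ∈ (0,2), as n, m → ∞ with n > m and m + n even, b_{mn} = θ_α (4/(n²-m²))^{α+1} (1 + O((m+n)^{-1}) + O((n-m)^{-2})), where θ_α = -sin(πα/2) Γ(α+1) Γ(α/2+1)² / π. -/

import Mathlib

open Real Finset

/-- Rising factorial (Pochhammer symbol) for a real argument. -/
noncomputable def poch (a : ℝ) (k : ℕ) : ℝ := ∏ j ∈ Finset.range k, (a + j)

/-- Jacobi polynomial `P_n^{(β,γ)}` normalized so that `P_n^{(β,γ)}(1) = 1`,
i.e. `P_n^{(β,γ)}(x) = ₂F₁(-n, n+β+γ+1; β+1; (1-x)/2)`. -/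
noncomputable def jacobiP (β γ : ℝ) (n : ℕ) (x : ℝ) : ℝ :=
  ∑ k ∈ Finset.range (n + 1),
    ((-1 : ℝ) ^ k * (n.choose k) * poch ((n : ℝ) + β + γ + 1) k / poch (β + 1) k) *
      ((1 - x) / 2) ^ k

/-- Coefficients of the Jacobi polynomial in the variable `(1 - x) / 2`. -/
noncomputable def cf (α : ℝ) (n k : ℕ) : ℝ :=
  (-1 : ℝ) ^ k * (n.choose k) * poch ((n : ℝ) + α / 2 + α / 2 + 1) k / poch (α / 2 + 1) k

lemma poch_succ (a : ℝ) (k : ℕ) : poch a (k + 1) = poch a k * (a + k) := by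
  simp [poch, Finset.prod_range_succ]

lemma poch_succ_left (a : ℝ) (k : ℕ) : poch a (k + 1) = a * poch (a + 1) k := by
  unfold poch
  rw [Finset.prod_range_succ', mul_comm]
  congr 1
  · simp
  · apply Finset.prod_congr rfl
    intro i _
    push_cast
    ring

lemma poch_zero (a : ℝ) : poch a 0 = 1 := by simp [poch]

lemma poch_pos {a : ℝ} (ha : 0 < a) (k : ℕ) : 0 < poch a k := by
  unfold poch
  apply Finset.prod_pos
  intro i _
  positivity

lemma cf_zero (α : ℝ) (n : ℕ) : cf α n 0 = 1 := by simp [cf, poch_zero]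

/-- All the neighbouring coefficients in terms of one. -/
lemma cf_rels (α : ℝ) (hα : 0 < α) (N j : ℕ) :
    ∃ R : ℝ, cf α (N + 1) j = R * ((j + 1) * (α / 2 + 1 + j)) * (N + 1) * (N + α + 2) ∧
      cf α (N + 1) (j + 1) = -R * ((N + 1 - j) * (N + α + 2 + j)) * (N + 1) * (N + α + 2) ∧
      cf α N (j + 1) = -R * ((N - j) * (N + 1 - j) * (N + α + 1)) * (N + α + 2) ∧
      cf α (N + 2) (j + 1) =
        -R * ((N + 2) * (N + α + 2 + j) * (N + α + 3 + j)) * (N + 1) := by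
  have hq : 0 < poch (α / 2 + 1) j := poch_pos (by positivity) j
  have h1 : ((N + 1).choose (j + 1) : ℝ) * (j + 1) = (N + 1).choose j * (N + 1 - j) := by
    rcases le_or_gt j (N + 1) with h | h
    · have := Nat.choose_succ_right_eq (N + 1) j
      have h' : (((N + 1).choose (j + 1) * (j + 1) : ℕ) : ℝ)
        = (((N + 1).choose j * (N + 1 - j) : ℕ) : ℝ) := by rw [this]
      push_cast [Nat.cast_sub h] at h'
      exact h'
    · rw [Nat.choose_eq_zero_of_lt h, Nat.choose_eq_zero_of_lt (by omega)]; simp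
  have h2 : (N.choose (j + 1) : ℝ) * (N + 1) = (N + 1).choose (j + 1) * (N - j) := by
    rcases le_or_gt j N with h | h
    · have := Nat.choose_mul_succ_eq N (j + 1)
      have h' : ((N.choose (j + 1) * (N + 1) : ℕ) : ℝ)
        = (((N + 1).choose (j + 1) * (N + 1 - (j + 1)) : ℕ) : ℝ) := by rw [this]
      rw [Nat.add_sub_add_right] at h'
      push_cast [Nat.cast_sub h] at h'
      exact h'
    · rw [Nat.choose_eq_zero_of_lt (show N < j + 1 by omega),
        Nat.choose_eq_zero_of_lt (show N + 1 < j + 1 by omega)]; simp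
  have h3 : ((N + 2 : ℕ) : ℝ) * (N + 1).choose j = (N + 2).choose (j + 1) * (j + 1) := by
    exact_mod_cast Nat.add_one_mul_choose_eq (N + 1) j
  set B : ℝ := (((N + 1).choose j : ℕ) : ℝ) with hB
  set P := poch (N + α + 2) j with hP
  have hj : (0 : ℝ) < j + 1 := by positivity
  have hN : (0 : ℝ) < N + 1 := by positivity
  have hb : (0 : ℝ) < α / 2 + 1 + j := by positivity
  have hA : (0 : ℝ) < N + α + 2 := by positivity
  have e1 : ((N + 1).choose (j + 1) : ℝ) = B * (N + 1 - j) / (j + 1) := by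
    field_simp; linarith
  have e2 : (N.choose (j + 1) : ℝ) = B * (N + 1 - j) / (j + 1) * (N - j) / (N + 1) := by
    rw [← e1]; field_simp; linarith
  have e3 : ((N + 2).choose (j + 1) : ℝ) = (N + 2) * B / (j + 1) := by
    field_simp; push_cast at h3; linarith
  have p1 : poch (N + α + 2) (j + 1) = P * (N + α + 2 + j) := poch_succ _ _
  have p2 : poch (N + α + 1) (j + 1) = (N + α + 1) * P := by
    rw [poch_succ_left, hP]; congr 2; ring
  have p3 : poch (N + α + 3) (j + 1) = P * (N + α + 2 + j) * (N + α + 3 + j) / (N + α + 2) := by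
    have := poch_succ_left (N + α + 2) (j + 1)
    rw [poch_succ, p1] at this
    rw [show (N : ℝ) + α + 3 = N + α + 2 + 1 by ring]
    field_simp
    rw [mul_comm] at this
    push_cast at this
    linear_combination -this
  refine ⟨(-1) ^ j * B * P / poch (α / 2 + 1) j /
    ((j + 1) * (α / 2 + 1 + j) * (N + 1) * (N + α + 2)), ?_, ?_, ?_, ?_⟩
  · unfold cf
    rw [show (((N + 1 : ℕ) : ℝ) + α / 2 + α / 2 + 1) = N + α + 2 by push_cast; ring]
    change (-1) ^ j * B * P / _ = _
    field_simp
  · unfold cf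
    rw [show (((N + 1 : ℕ) : ℝ) + α / 2 + α / 2 + 1) = N + α + 2 by push_cast; ring, p1, e1,
      poch_succ (α / 2 + 1)]
    field_simp
    ring
  · unfold cf
    rw [show ((N : ℝ) + α / 2 + α / 2 + 1) = N + α + 1 by ring, p2, e2,
      poch_succ (α / 2 + 1)]
    field_simp
    ring
  · unfold cf
    rw [show (((N + 2 : ℕ) : ℝ) + α / 2 + α / 2 + 1) = N + α + 3 by push_cast; ring, p3, e3,
      poch_succ (α / 2 + 1)]
    field_simp
    ring

open Polynomial in
/-- The Jacobi polynomial in the variable `(1 - x) / 2`. -/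
noncomputable def jq (α : ℝ) (n : ℕ) : Polynomial ℝ :=
  ∑ k ∈ Finset.range (n + 1), Polynomial.C (cf α n k) * Polynomial.X ^ k

lemma jq_coeff (α : ℝ) (n k : ℕ) : (jq α n).coeff k = cf α n k := by
  unfold jq
  simp only [Polynomial.finsetSum_coeff, Polynomial.coeff_C_mul_X_pow]
  rw [Finset.sum_ite_eq]
  split_ifs with h
  · rfl
  · have : n < k := by simpa using h
    simp [cf, Nat.choose_eq_zero_of_lt this]

lemma jacobiP_eq (α : ℝ) (n : ℕ) (x : ℝ) :
    jacobiP (α / 2) (α / 2) n x = (jq α n).eval ((1 - x) / 2) := by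
  unfold jacobiP jq
  rw [Polynomial.eval_finsetSum]
  simp [cf]

lemma coeff_X_deriv (p : Polynomial ℝ) (k : ℕ) :
    (Polynomial.X * Polynomial.derivative p).coeff k = k * p.coeff k := by
  cases k with
  | zero => simp
  | succ k => rw [Polynomial.coeff_X_mul, Polynomial.coeff_derivative]; push_cast; ring

lemma jq_deriv (α : ℝ) (hα : 0 < α) (N : ℕ) :
    Polynomial.C (-2 : ℝ) * (Polynomial.X * Polynomial.derivative (jq α (N + 1))
      - Polynomial.X * (Polynomial.X * Polynomial.derivative (jq α (N + 1)))) =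
    Polynomial.C ((N : ℝ) + 1) * (jq α N - (jq α (N + 1)
      - Polynomial.C 2 * (Polynomial.X * jq α (N + 1)))) := by
  ext k
  cases k with
  | zero => simp [jq_coeff, cf_zero]
  | succ j =>
    rw [Polynomial.coeff_C_mul, Polynomial.coeff_C_mul, Polynomial.coeff_sub, Polynomial.coeff_sub,
      Polynomial.coeff_sub, Polynomial.coeff_C_mul, coeff_X_deriv,
      Polynomial.coeff_X_mul _ j, coeff_X_deriv, Polynomial.coeff_X_mul _ j]
    simp only [jq_coeff]
    obtain ⟨R, h1, h2, h3, h4⟩ := cf_rels α hα N j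
    rw [h1, h2, h3]
    push_cast
    ring

lemma jq_rec (α : ℝ) (hα : 0 < α) (N : ℕ) :
    Polynomial.C (2 * (N + 1) + α + 1) * (jq α (N + 1)
      - Polynomial.C 2 * (Polynomial.X * jq α (N + 1))) =
    Polynomial.C (N + α + 2) * jq α (N + 2) + Polynomial.C ((N : ℝ) + 1) * jq α N := by
  ext k
  cases k with
  | zero => simp [jq_coeff, cf_zero]; ring
  | succ j =>
    simp only [Polynomial.coeff_C_mul, Polynomial.coeff_sub, Polynomial.coeff_add,
      Polynomial.coeff_X_mul, jq_coeff]
    obtain ⟨R, h1, h2, h3, h4⟩ := cf_rels α hα N j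
    rw [h1, h2, h3, h4]
    ring

/-- abbreviation for the Jacobi polynomial -/
noncomputable def J (α : ℝ) (n : ℕ) (x : ℝ) : ℝ := jacobiP (α / 2) (α / 2) n x

lemma J_zero (α x : ℝ) : J α 0 x = 1 := by
  simp [J, jacobiP, poch]

lemma J_one (α x : ℝ) (hα : 0 < α) : J α 1 x = x := by
  have : α / 2 + 1 ≠ 0 := by positivity
  simp [J, jacobiP, poch, Finset.sum_range_succ]
  field_simp
  ring

lemma J_rec (α : ℝ) (hα : 0 < α) (N : ℕ) (x : ℝ) :
    (2 * (N + 1) + α + 1) * (x * J α (N + 1) x) =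
      (N + α + 2) * J α (N + 2) x + (N + 1) * J α N x := by
  have := congrArg (Polynomial.eval ((1 - x) / 2)) (jq_rec α hα N)
  simp only [Polynomial.eval_mul, Polynomial.eval_sub, Polynomial.eval_add, Polynomial.eval_C,
    Polynomial.eval_X, ← jacobiP_eq] at this
  change _ * (J α (N + 1) x - 2 * (_ * J α (N + 1) x)) = _ * J α (N + 2) x + _ * J α N x at this
  rw [← this]
  ring

lemma J_hasDeriv (α : ℝ) (n : ℕ) (x : ℝ) :
    HasDerivAt (J α n) (-(1 / 2) * (Polynomial.derivative (jq α n)).eval ((1 - x) / 2)) x := by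
  have h1 : J α n = fun x => (jq α n).eval ((1 - x) / 2) := by
    funext y; exact jacobiP_eq α n y
  rw [h1]
  have h2 : HasDerivAt (fun x : ℝ => (1 - x) / 2) (-(1 / 2)) x := by
    have := ((hasDerivAt_id x).const_sub 1).div_const 2
    simpa [neg_div] using this
  have h3 := ((jq α n).hasDerivAt ((1 - x) / 2)).comp x h2
  rw [mul_comm]
  exact h3

lemma J_cont (α : ℝ) (n : ℕ) : Continuous (J α n) :=
  continuous_iff_continuousAt.2 fun x => (J_hasDeriv α n x).continuousAt

lemma J_deriv_rel (α : ℝ) (hα : 0 < α) (N : ℕ) (x : ℝ) :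
    (1 - x ^ 2) * (-(1 / 2) * (Polynomial.derivative (jq α (N + 1))).eval ((1 - x) / 2)) =
      (N + 1) * (J α N x - x * J α (N + 1) x) := by
  have := congrArg (Polynomial.eval ((1 - x) / 2)) (jq_deriv α hα N)
  simp only [Polynomial.eval_mul, Polynomial.eval_sub, Polynomial.eval_add, Polynomial.eval_C,
    Polynomial.eval_X, ← jacobiP_eq] at this
  change _ = _ * (J α N x - (J α (N + 1) x - 2 * (_ * J α (N + 1) x))) at this
  linear_combination this

/-- The integrals. -/
noncomputable def bI (α : ℝ) (m n : ℕ) : ℝ :=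
  ∫ x in (-1 : ℝ)..1, (1 - x ^ 2) ^ α * J α m x * J α n x

lemma w_cont (α : ℝ) (hα : 0 < α) : Continuous fun x : ℝ => (1 - x ^ 2) ^ α :=
  Continuous.rpow_const (by fun_prop) (fun _ => Or.inr hα.le)

lemma bI_int (α : ℝ) (hα : 0 < α) (f : ℝ → ℝ) (hf : Continuous f) :
    IntervalIntegrable (fun x => (1 - x ^ 2) ^ α * f x) MeasureTheory.volume (-1) 1 :=
  ((w_cont α hα).mul hf).intervalIntegrable _ _

/-- Weighted integral. -/
noncomputable def wI (α : ℝ) (f : ℝ → ℝ) : ℝ := ∫ x in (-1 : ℝ)..1, (1 - x ^ 2) ^ α * f x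

lemma wI_add (α : ℝ) (hα : 0 < α) (f g : ℝ → ℝ) (hf : Continuous f) (hg : Continuous g)
    (a b : ℝ) : wI α (fun x => a * f x + b * g x) = a * wI α f + b * wI α g := by
  unfold wI
  rw [← intervalIntegral.integral_const_mul, ← intervalIntegral.integral_const_mul,
    ← intervalIntegral.integral_add ((bI_int α hα f hf).const_mul a)
      ((bI_int α hα g hg).const_mul b)]
  congr 1
  funext x
  ring

lemma bI_eq (α : ℝ) (m n : ℕ) : bI α m n = wI α (fun x => J α m x * J α n x) := by
  unfold bI wI
  congr 1
  funext x
  ring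

lemma wI_left (α : ℝ) (hα : 0 < α) (m n : ℕ) :
    (2 * (m + 1) + α + 1) * wI α (fun x => x * J α (m + 1) x * J α n x) =
      (m + α + 2) * bI α (m + 2) n + (m + 1) * bI α m n := by
  rw [bI_eq, bI_eq, ← wI_add α hα (fun x => J α (m + 2) x * J α n x) (fun x => J α m x * J α n x)
    ((J_cont _ _).mul (J_cont _ _)) ((J_cont _ _).mul (J_cont _ _))]
  have := wI_add α hα (fun x => x * J α (m + 1) x * J α n x) (fun _ => 0)
    ((continuous_id.mul (J_cont _ _)).mul (J_cont _ _)) continuous_const (2 * (m + 1) + α + 1) 0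
  simp only [zero_mul, add_zero] at this
  rw [← this]
  congr 1
  funext x
  linear_combination J α n x * J_rec α hα m x

lemma bI_comm (α : ℝ) (m n : ℕ) : bI α m n = bI α n m := by
  unfold bI
  congr 1
  funext x
  ring

lemma wI_comm (α : ℝ) (m n : ℕ) : wI α (fun x => x * J α m x * J α n x) =
    wI α (fun x => x * J α n x * J α m x) := by
  congr 1
  funext x
  ring

lemma bI_rec (α : ℝ) (hα : 0 < α) (m n : ℕ) :
    (2 * (n + 1) + α + 1) * ((m + α + 2) * bI α (m + 2) (n + 1) + (m + 1) * bI α m (n + 1)) =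
    (2 * (m + 1) + α + 1) * ((n + α + 2) * bI α (m + 1) (n + 2) + (n + 1) * bI α (m + 1) n) := by
  rw [← wI_left α hα m (n + 1), bI_comm α (m + 1) (n + 2), bI_comm α (m + 1) n,
    ← wI_left α hα n (m + 1), wI_comm]
  ring

lemma bI_rec0 (α : ℝ) (hα : 0 < α) (n : ℕ) :
    (2 * (n + 1) + α + 1) * bI α 1 (n + 1) =
      (n + α + 2) * bI α 0 (n + 2) + (n + 1) * bI α 0 n := by
  rw [bI_comm α 0 (n + 2), bI_comm α 0 n, ← wI_left α hα n 0, bI_eq]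
  congr 2
  funext x
  rw [J_zero, J_one α x hα]
  ring

lemma bI_base_rec (α : ℝ) (hα : 0 < α) (n : ℕ) :
    (n + 2 * α + 3) * (n + α + 2) * bI α 0 (n + 2) = (n + 1) * (n - α) * bI α 0 n := by
  have hD : ∀ x ∈ Set.uIcc (-1 : ℝ) 1, HasDerivAt (fun x => (1 - x ^ 2) ^ (α + 1) * J α (n + 1) x)
      ((1 - x ^ 2) ^ α * (-(2 * α + 3 + n) * (x * J α (n + 1) x * J α 0 x)
        + (n + 1) * (J α n x * J α 0 x))) x := by
    intro x hx
    rw [Set.uIcc_of_le (by norm_num)] at hx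
    have hx0 : 0 ≤ 1 - x ^ 2 := by nlinarith [hx.1, hx.2]
    have h1 : HasDerivAt (fun x : ℝ => 1 - x ^ 2) (-(2 * x)) x := by
      simpa using (hasDerivAt_pow 2 x).const_sub 1
    have h2 := h1.rpow_const (p := α + 1) (Or.inr (by linarith))
    have h3 := h2.mul (J_hasDeriv α (n + 1) x)
    refine h3.congr_deriv ?_
    rw [show α + 1 - 1 = α by ring, Real.rpow_add_one' hx0 (by linarith), J_zero, mul_assoc _ (1 - x ^ 2), J_deriv_rel α hα]
    ring
  have hc : Continuous fun x => (-(2 * α + 3 + n) * (x * J α (n + 1) x * J α 0 x)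
        + (n + 1) * (J α n x * J α 0 x)) :=
    (((continuous_id.mul (J_cont _ _)).mul (J_cont _ _)).const_mul _).add
      (((J_cont _ _).mul (J_cont _ _)).const_mul _)
  have h := intervalIntegral.integral_eq_sub_of_hasDerivAt hD (bI_int α hα _ hc)
  have h0 : wI α (fun x => (-(2 * α + 3 + n) * (x * J α (n + 1) x * J α 0 x)
        + (n + 1) * (J α n x * J α 0 x))) = 0 := by
    unfold wI
    rw [h]
    norm_num
    rw [Real.zero_rpow (by linarith)]
    ring
  rw [wI_add α hα (fun x => x * J α (n + 1) x * J α 0 x) (fun x => J α n x * J α 0 x)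
    ((continuous_id.mul (J_cont _ _)).mul (J_cont _ _))
    ((J_cont _ _).mul (J_cont _ _)), ← bI_eq] at h0
  have h1 := wI_left α hα n 0
  rw [bI_comm α 0 (n + 2), bI_comm α 0 n]
  linear_combination (-(2 * α + 3 + n)) * h1 - (2 * (n + 1) + α + 1) * h0

lemma bI_zero (α : ℝ) (hα : 0 < α) :
    bI α 0 0 = √π * Real.Gamma (α + 1) / Real.Gamma (α + 3 / 2) := by
  have h1 : bI α 0 0 = ∫ x in (-1 : ℝ)..1, (1 - x ^ 2) ^ α := by
    unfold bI
    simp [J_zero]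
  have h2 : ∫ x in (0 : ℝ)..1, (1 - (2 * x - 1) ^ 2) ^ α
      = (2 : ℝ)⁻¹ • ∫ x in (-1 : ℝ)..1, (1 - x ^ 2) ^ α := by
    have := intervalIntegral.integral_comp_mul_sub (a := 0) (b := 1)
      (fun x : ℝ => (1 - x ^ 2) ^ α) (c := 2) (by norm_num) 1
    norm_num at this ⊢
    exact this
  have h3 : ∫ x in (0 : ℝ)..1, (1 - (2 * x - 1) ^ 2) ^ α
      = 4 ^ α * ∫ x in (0 : ℝ)..1, x ^ α * (1 - x) ^ α := by
    rw [← intervalIntegral.integral_const_mul]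
    apply intervalIntegral.integral_congr
    intro x hx
    rw [Set.uIcc_of_le (by norm_num)] at hx
    simp only
    have := hx.1
    have := hx.2
    rw [← Real.mul_rpow (by linarith) (by linarith), ← Real.mul_rpow (by norm_num) (by nlinarith)]
    congr 1
    ring
  have h4 : ∫ x in (0 : ℝ)..1, x ^ α * (1 - x) ^ α = ProbabilityTheory.beta (α + 1) (α + 1) := by
    rw [ProbabilityTheory.beta_eq_betaIntegralReal _ _ (by linarith) (by linarith)]
    unfold Complex.betaIntegral
    have : (∫ x in (0 : ℝ)..1, (x : ℂ) ^ (((α + 1 : ℝ) : ℂ) - 1) *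
        (1 - (x : ℂ)) ^ (((α + 1 : ℝ) : ℂ) - 1))
        = ∫ x in (0 : ℝ)..1, ((x ^ α * (1 - x) ^ α : ℝ) : ℂ) := by
      apply intervalIntegral.integral_congr
      intro x hx
      rw [Set.uIcc_of_le (by norm_num)] at hx
      simp only
      rw [Complex.ofReal_mul, Complex.ofReal_cpow hx.1, Complex.ofReal_cpow (by linarith [hx.2])]
      push_cast
      ring_nf
    rw [this, intervalIntegral.integral_ofReal, Complex.ofReal_re]
  have h5 := Real.Gamma_mul_Gamma_add_half (α + 1)
  have g1 : 0 < Real.Gamma (α + 1) := Real.Gamma_pos_of_pos (by linarith)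
  have g2 : 0 < Real.Gamma (α + 3 / 2) := Real.Gamma_pos_of_pos (by linarith)
  have g3 : 0 < Real.Gamma (2 * (α + 1)) := Real.Gamma_pos_of_pos (by linarith)
  rw [show α + 1 + 1 / 2 = α + 3 / 2 by ring] at h5
  rw [h3, h4, smul_eq_mul, ← h1] at h2
  have h6 : bI α 0 0 = 2 * 4 ^ α * ProbabilityTheory.beta (α + 1) (α + 1) := by linarith
  rw [h6, ProbabilityTheory.beta, ← two_mul]
  have h7 : (2 : ℝ) ^ (1 - 2 * (α + 1)) * (2 * 4 ^ α) = 1 := by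
    rw [show (4 : ℝ) = 2 ^ (2 : ℝ) by norm_num, ← Real.rpow_mul (by norm_num)]
    rw [show 1 - 2 * (α + 1) = -(1 + 2 * α) by ring, Real.rpow_neg (by norm_num),
      Real.rpow_add (by norm_num), Real.rpow_one]
    exact inv_mul_cancel₀ (by positivity)
  rw [← mul_div_assoc, div_eq_div_iff g3.ne' g2.ne']
  linear_combination (2 * 4 ^ α * Real.Gamma (α + 1)) * h5 +
    Real.Gamma (α + 1) *(Real.Gamma (2 * (α + 1)) * √π) * h7

/-- First gamma quotient. -/
noncomputable def gs (α : ℝ) (s : ℕ) : ℝ :=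
  Real.Gamma (s + 1 / 2) / Real.Gamma (s + (3 / 2 + α))

/-- Second gamma quotient. -/
noncomputable def hd (α : ℝ) (d : ℕ) : ℝ :=
  Real.Gamma (d + (-(α / 2))) / Real.Gamma (d + (α / 2 + 1))

/-- The constant. -/
noncomputable def th (α : ℝ) : ℝ :=
  -(Real.sin (Real.pi * α / 2) * Real.Gamma (α + 1) * Real.Gamma (α / 2 + 1) ^ 2) / Real.pi

lemma gs_succ (α : ℝ) (hα : 0 < α) (s : ℕ) :
    gs α (s + 1) * (s + 3 / 2 + α) = gs α s * (s + 1 / 2) := by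
  unfold gs
  have h1 : (s : ℝ) + 1 / 2 ≠ 0 := by positivity
  have h2 : (s : ℝ) + (3 / 2 + α) ≠ 0 := by positivity
  have h3 : Real.Gamma (s + (3 / 2 + α)) ≠ 0 := (Real.Gamma_pos_of_pos (by positivity)).ne'
  push_cast
  rw [show (s : ℝ) + 1 + 1 / 2 = (s + 1 / 2) + 1 by ring,
    show (s : ℝ) + 1 + (3 / 2 + α) = (s + (3 / 2 + α)) + 1 by ring,
    Real.Gamma_add_one h1, Real.Gamma_add_one h2]
  rw [div_mul_eq_mul_div, div_mul_eq_mul_div, div_eq_div_iff (mul_ne_zero h2 h3) h3]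
  ring

lemma ne_half (α : ℝ) (h0 : 0 < α) (h2 : α < 2) (d : ℕ) : (d : ℝ) + (-(α / 2)) ≠ 0 := by
  cases d with
  | zero => push_cast; intro h; linarith
  | succ d => push_cast; intro h; have : (0 : ℝ) ≤ d := by positivity
              linarith

lemma hd_succ (α : ℝ) (h0 : 0 < α) (h2 : α < 2) (d : ℕ) :
    hd α (d + 1) * (d + α / 2 + 1) = hd α d * (d - α / 2) := by
  unfold hd
  have h1 := ne_half α h0 h2 d
  have h2 : (d : ℝ) + (α / 2 + 1) ≠ 0 := by positivity
  have h3 : Real.Gamma (d + (α / 2 + 1)) ≠ 0 := (Real.Gamma_pos_of_pos (by positivity)).ne'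
  push_cast
  rw [show (d : ℝ) + 1 + (-(α / 2)) = (d + (-(α / 2))) + 1 by ring,
    show (d : ℝ) + 1 + (α / 2 + 1) = (d + (α / 2 + 1)) + 1 by ring,
    Real.Gamma_add_one h1, Real.Gamma_add_one h2]
  rw [div_mul_eq_mul_div, div_mul_eq_mul_div, div_eq_div_iff (mul_ne_zero h2 h3) h3]
  ring

lemma closed_base (α : ℝ) (h0 : 0 < α) (h2 : α < 2) (d : ℕ) :
    bI α 0 (2 * d) = th α * (gs α d * hd α d) := by
  induction d with
  | zero =>
    rw [mul_zero, bI_zero α h0]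
    unfold th gs hd
    have hr := Real.Gamma_mul_Gamma_one_sub (-(α / 2))
    have hs : 0 < Real.sin (Real.pi * α / 2) :=
      Real.sin_pos_of_pos_of_lt_pi (by positivity) (by nlinarith [Real.pi_pos])
    rw [show Real.pi * -(α / 2) = -(Real.pi * α / 2) by ring, Real.sin_neg,
      show 1 - -(α / 2) = α / 2 + 1 by ring] at hr
    have g1 : 0 < Real.Gamma (α / 2 + 1) := Real.Gamma_pos_of_pos (by linarith)
    have g2 : 0 < Real.Gamma (α + 3 / 2) := Real.Gamma_pos_of_pos (by linarith)
    have hr' : Real.Gamma (-(α / 2)) =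
        -(Real.pi / Real.sin (Real.pi * α / 2)) / Real.Gamma (α / 2 + 1) := by
      rw [eq_div_iff g1.ne', hr, div_neg]
    simp only [Nat.cast_zero, zero_add]
    rw [hr', Real.Gamma_one_half_eq, add_comm (3 / 2) α]
    have := Real.pi_pos
    generalize Real.Gamma (α + 3 / 2) = G at *
    generalize Real.sin (Real.pi * α / 2) = S at *
    generalize Real.Gamma (α / 2 + 1) = H at *
    field_simp
  | succ d ih =>
    have h := bI_base_rec α h0 (2 * d)
    rw [show 2 * (d + 1) = 2 * d + 2 by ring]
    rw [ih] at h
    have e1 := gs_succ α h0 d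
    have e2 := hd_succ α h0 h2 d
    have hne : (((2 * d : ℕ) : ℝ) + 2 * α + 3) * (((2 * d : ℕ) : ℝ) + α + 2) ≠ 0 := by positivity
    apply mul_left_cancel₀ hne
    rw [h]
    push_cast
    linear_combination (-4 * th α * hd α (d + 1) * (d + α / 2 + 1)) * e1
      - 4 * th α * gs α d * (d + 1 / 2) * e2

lemma closed_form (α : ℝ) (h0 : 0 < α) (h2 : α < 2) (m : ℕ) :
    (∀ d, bI α m (m + 2 * d) = th α * (gs α (m + d) * hd α d)) ∧
    (∀ d, bI α (m + 1) (m + 1 + 2 * d) = th α * (gs α (m + 1 + d) * hd α d)) := by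
  induction m with
  | zero =>
    have hb := closed_base α h0 h2
    refine ⟨fun d => by simpa using hb d, fun d => ?_⟩
    have h := bI_rec0 α h0 (2 * d)
    rw [show 2 * d + 2 = 2 * (d + 1) by ring, hb, hb] at h
    rw [show 0 + 1 + 2 * d = 2 * d + 1 by ring, show 0 + 1 + d = d + 1 by ring]
    have e1 := gs_succ α h0 d
    have e2 := hd_succ α h0 h2 d
    have hne : 2 * (((2 * d : ℕ) : ℝ) + 1) + α + 1 ≠ 0 := by positivity
    apply mul_left_cancel₀ hne
    rw [h]
    push_cast
    linear_combination (2 * th α * gs α (d + 1)) * e2 - 2 * th α * hd α d * e1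
  | succ m ih =>
    obtain ⟨ih1, ih2⟩ := ih
    refine ⟨ih2, fun d => ?_⟩
    have h := bI_rec α h0 m (m + 1 + 2 * d)
    have a1 := ih1 (d + 1)
    have a2 := ih2 (d + 1)
    have a3 := ih2 d
    rw [show m + 2 * (d + 1) = m + 1 + 2 * d + 1 by ring] at a1
    rw [show m + 1 + 2 * (d + 1) = m + 1 + 2 * d + 2 by ring] at a2
    rw [a1, a2, a3] at h
    rw [show m + 1 + 1 + 2 * d = m + 1 + 2 * d + 1 by ring]
    rw [show m + (d + 1) = m + d + 1 by ring, show m + 1 + (d + 1) = m + d + 2 by ring,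
      show m + 1 + d = m + d + 1 by ring] at h
    rw [show m + 1 + 1 + d = m + d + 2 by ring]
    have e1 := gs_succ α h0 (m + d + 1)
    have e2 := hd_succ α h0 h2 d
    have hA : (2 * (((m + 1 + 2 * d : ℕ) : ℝ) + 1) + α + 1) ≠ 0 := by positivity
    have hB : ((m : ℝ) + α + 2) ≠ 0 := by positivity
    have hG : ((m : ℝ) + d + 1) + 1 / 2 ≠ 0 := by positivity
    have hH : (d : ℝ) + α / 2 + 1 ≠ 0 := by positivity
    push_cast at e1 h hA
    have e1' : gs α (m + d + 1) = gs α (m + d + 2) * (m + d + 1 + 3 / 2 + α) /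
        ((m : ℝ) + d + 1 + 1 / 2) := by
      rw [eq_div_iff hG, ← e1]
    have e2' : hd α (d + 1) = hd α d * (d - α / 2) / ((d : ℝ) + α / 2 + 1) := by
      rw [eq_div_iff hH, ← e2]
    apply mul_left_cancel₀ (mul_ne_zero hA hB)
    rw [e1', e2'] at h
    generalize gs α (m + d + 2) = G at *
    generalize hd α d = H at *
    clear e1 e2 e1' e2' a1 a2 a3 ih1 ih2
    have h' : (2 * ((m : ℝ) + 1 + 2 * d + 1) + α + 1) * ((m + α + 2) *
        bI α (m + 2) (m + 1 + 2 * d + 1)) = _ :=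
      (eq_sub_of_add_eq ((mul_add _ _ _).symm.trans h))
    rw [mul_assoc, h']
    have hG2 : (m : ℝ) + d + 1 + 1 / 2 ≠ 0 := hG
    field_simp
    ring

open Filter Topology in
lemma tail_bound (p : ℕ)
    (hp : ∀ k : ℕ, 1 ≤ k → 1 / (k : ℝ) ^ (p + 1) ≤ 2 * (1 / (k : ℝ) ^ p - 1 / ((k : ℝ) + 1) ^ p))
    (hp0 : p ≠ 0) (v : ℕ → ℝ) (hv : Tendsto v atTop (𝓝 0)) (K : ℝ) (hK : 0 ≤ K) (N : ℕ)
    (hN : 1 ≤ N) (hD : ∀ k, N ≤ k → |v (k + 1) - v k| ≤ K / (k : ℝ) ^ (p + 1)) :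
    ∀ k, N ≤ k → |v k| ≤ 2 * K / (k : ℝ) ^ p := by
  have hz : Tendsto (fun k : ℕ => 2 * K / (k : ℝ) ^ p) atTop (𝓝 0) :=
    tendsto_const_nhds.div_atTop ((tendsto_pow_atTop hp0).comp tendsto_natCast_atTop_atTop)
  have hstep : ∀ k, N ≤ k → |v (k + 1) - v k| ≤
      2 * K / (k : ℝ) ^ p - 2 * K / ((k + 1 : ℕ) : ℝ) ^ p := by
    intro k hk
    refine (hD k hk).trans ?_
    have := mul_le_mul_of_nonneg_left (hp k (by omega)) hK
    push_cast
    calc K / (k : ℝ) ^ (p + 1) = K * (1 / (k : ℝ) ^ (p + 1)) := by ring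
      _ ≤ _ := this
      _ = _ := by ring
  intro k hk
  rw [abs_le]
  constructor
  · have h1 : Antitone fun j : ℕ => v (k + j) + 2 * K / ((k + j : ℕ) : ℝ) ^ p := by
      apply antitone_nat_of_succ_le
      intro j
      have := (abs_le.1 (hstep (k + j) (by omega))).2
      rw [← add_assoc]
      linarith
    have h2 : Tendsto (fun j : ℕ => v (k + j) + 2 * K / ((k + j : ℕ) : ℝ) ^ p) atTop (𝓝 0) := by
      have := (hv.add hz).comp (tendsto_add_atTop_nat k)
      rw [add_zero] at this
      refine this.congr fun j => ?_
      simp [add_comm]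
    have := h1.le_of_tendsto h2 0
    simp only [add_zero] at this
    linarith [neg_div ((k : ℝ) ^ p) (2 * K)]
  · have h1 : Monotone fun j : ℕ => v (k + j) - 2 * K / ((k + j : ℕ) : ℝ) ^ p := by
      apply monotone_nat_of_le_succ
      intro j
      have := (abs_le.1 (hstep (k + j) (by omega))).1
      rw [← add_assoc]
      linarith
    have h2 : Tendsto (fun j : ℕ => v (k + j) - 2 * K / ((k + j : ℕ) : ℝ) ^ p) atTop (𝓝 0) := by
      have := (hv.sub hz).comp (tendsto_add_atTop_nat k)
      rw [sub_zero] at this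
      refine this.congr fun j => ?_
      simp [add_comm]
    have := h1.ge_of_tendsto h2 0
    simp only [add_zero] at this
    linarith

lemma gamma_prod (s : ℝ) (hs : ∀ j : ℕ, s + j ≠ 0) (n : ℕ) :
    (∏ j ∈ Finset.range n, (s + j)) * Real.Gamma s = Real.Gamma (s + n) := by
  induction n with
  | zero => simp
  | succ n ih =>
    rw [Finset.prod_range_succ, Nat.cast_succ, ← add_assoc, Real.Gamma_add_one (hs n), ← ih]
    ring

/-- Normalized gamma quotient. -/
noncomputable def rr (a b : ℝ) (k : ℕ) : ℝ :=
  Real.Gamma (k + a) / Real.Gamma (k + b) * (k : ℝ) ^ (b - a)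

open Filter Topology in
lemma seq_tendsto (a : ℝ) (ha : ∀ j : ℕ, a - 1 + j ≠ 0) :
    Tendsto (fun k : ℕ => (k : ℝ) ^ (a - 1) * k.factorial / Real.Gamma (k + a)) atTop (𝓝 1) := by
  have hne : Real.Gamma (a - 1) ≠ 0 := by
    apply Real.Gamma_ne_zero
    intro m h
    apply ha m
    rw [h]; ring
  have h := (Real.GammaSeq_tendsto_Gamma (a - 1)).div_const (Real.Gamma (a - 1))
  rw [div_self hne] at h
  refine h.congr fun k => ?_
  unfold Real.GammaSeq
  rw [div_div, gamma_prod _ ha]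
  congr 2
  push_cast
  ring

open Filter Topology in
lemma rr_tendsto (a b : ℝ) (ha : ∀ j : ℕ, a - 1 + j ≠ 0) (hb : ∀ j : ℕ, b - 1 + j ≠ 0) :
    Tendsto (rr a b) atTop (𝓝 1) := by
  have h := (seq_tendsto b hb).div (seq_tendsto a ha) one_ne_zero
  rw [div_one] at h
  refine h.congr' ?_
  filter_upwards [eventually_ge_atTop 1] with k hk
  have hk0 : (0 : ℝ) < k := by exact_mod_cast hk
  have e : (k : ℝ) ^ (b - 1) = (k : ℝ) ^ (a - 1) * (k : ℝ) ^ (b - a) := by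
    rw [← Real.rpow_add hk0]; congr 1; ring
  have p1 : (k : ℝ) ^ (a - 1) ≠ 0 := (Real.rpow_pos_of_pos hk0 _).ne'
  have p2 : (k.factorial : ℝ) ≠ 0 := by positivity
  simp only [Pi.div_apply]
  unfold rr
  rw [e, div_div_div_eq]
  rw [show (k : ℝ) ^ (a - 1) * (k : ℝ) ^ (b - a) * k.factorial * Real.Gamma (k + a) =
    ((k : ℝ) ^ (a - 1) * k.factorial) * (Real.Gamma (k + a) * (k : ℝ) ^ (b - a)) by ring,
    mul_comm (Real.Gamma (k + b)), mul_div_mul_left _ _ (mul_ne_zero p1 p2)]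
  ring

lemma log_bound {x : ℝ} (hx : |x| ≤ 1 / 2) :
    |Real.log (1 + x) - x + x ^ 2 / 2| ≤ 2 * |x| ^ 3 := by
  have h := Real.abs_log_sub_add_sum_range_le (x := -x) (by rw [abs_neg]; linarith) 2
  rw [abs_neg, sub_neg_eq_add] at h
  simp only [Finset.sum_range_succ, Finset.sum_range_zero] at h
  norm_num at h
  have e : -x + x ^ 2 / 2 + Real.log (1 + x) = Real.log (1 + x) - x + x ^ 2 / 2 := by ring
  rw [e] at h
  refine h.trans ?_
  rw [div_le_iff₀ (by linarith)]
  nlinarith [pow_nonneg (abs_nonneg x) 3]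

lemma log_rr_step (a b : ℝ) (ha : -1 < a) (hb : -1 < b) (k : ℕ) (hk : 1 ≤ k) :
    Real.log (rr a b (k + 1)) - Real.log (rr a b k) =
      Real.log (1 + a / k) - Real.log (1 + b / k) + (b - a) * Real.log (1 + 1 / k) := by
  have hk1 : (1 : ℝ) ≤ k := by exact_mod_cast hk
  have hk0 : (0 : ℝ) < k := by linarith
  have pa : 0 < (k : ℝ) + a := by linarith
  have pb : 0 < (k : ℝ) + b := by linarith
  have ga := Real.Gamma_pos_of_pos pa
  have gb := Real.Gamma_pos_of_pos pb
  unfold rr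
  push_cast
  rw [show (k : ℝ) + 1 + a = k + a + 1 by ring, show (k : ℝ) + 1 + b = k + b + 1 by ring,
    Real.Gamma_add_one pa.ne', Real.Gamma_add_one pb.ne',
    Real.log_mul (by positivity) (by positivity), Real.log_div (by positivity) (by positivity),
    Real.log_mul pa.ne' ga.ne', Real.log_mul pb.ne' gb.ne', Real.log_rpow (by positivity),
    Real.log_mul (by positivity) (by positivity), Real.log_div (by positivity) (by positivity),
    Real.log_rpow (by positivity),
    show 1 + a / (k : ℝ) = (k + a) / k by field_simp,
    show 1 + b / (k : ℝ) = (k + b) / k by field_simp,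
    show 1 + 1 / (k : ℝ) = (k + 1) / k by field_simp,
    Real.log_div pa.ne' hk0.ne', Real.log_div pb.ne' hk0.ne',
    Real.log_div (by positivity) hk0.ne']
  ring

lemma step_bound (a b : ℝ) (ha : -1 < a) (hb : -1 < b) :
    ∃ K : ℝ, 0 ≤ K ∧ ∃ N : ℕ, 1 ≤ N ∧ ∀ k : ℕ, N ≤ k →
      |Real.log (rr a b (k + 1)) - Real.log (rr a b k) - (b - a) * (a + b - 1) / 2 / (k : ℝ) ^ 2|
        ≤ K / (k : ℝ) ^ 3 := by
  obtain ⟨N, hN⟩ := exists_nat_ge (2 * (|a| + |b| + 1))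
  refine ⟨2 * |a| ^ 3 + 2 * |b| ^ 3 + |b - a| * 2, by positivity, max N 1, le_max_right _ _, ?_⟩
  intro k hk
  have hk1 : 1 ≤ k := le_trans (le_max_right _ _) hk
  have hkN : (N : ℝ) ≤ k := by exact_mod_cast le_trans (le_max_left _ _) hk
  have hk0 : (0 : ℝ) < k := by exact_mod_cast hk1
  have key : ∀ c : ℝ, |c| ≤ |a| + |b| + 1 →
      |Real.log (1 + c / k) - c / k + (c / k) ^ 2 / 2| ≤ 2 * |c| ^ 3 / (k : ℝ) ^ 3 := by
    intro c hc
    have h1 : |c / (k : ℝ)| = |c| / k := by rw [abs_div, abs_of_pos hk0]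
    have := log_bound (x := c / k) (by rw [h1, div_le_iff₀ hk0]; linarith)
    rw [h1, div_pow (|c|), ← mul_div_assoc] at this
    exact this
  have ka := key a (by linarith [abs_nonneg b])
  have kb := key b (by linarith [abs_nonneg a])
  have k1 := key 1 (by rw [abs_one]; linarith [abs_nonneg a, abs_nonneg b])
  rw [log_rr_step a b ha hb k hk1]
  rw [abs_one] at k1
  set A := Real.log (1 + a / k) - a / k + (a / k) ^ 2 / 2
  set B := Real.log (1 + b / k) - b / k + (b / k) ^ 2 / 2
  set D := Real.log (1 + 1 / (k : ℝ)) - 1 / k + (1 / (k : ℝ)) ^ 2 / 2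
  have e : Real.log (1 + a / k) - Real.log (1 + b / k) + (b - a) * Real.log (1 + 1 / k)
      - (b - a) * (a + b - 1) / 2 / (k : ℝ) ^ 2 = A - B + (b - a) * D := by
    simp only [A, B, D]
    field_simp
    ring
  rw [e]
  calc |A - B + (b - a) * D| ≤ |A - B| + |(b - a) * D| := abs_add_le _ _
    _ ≤ |A| + |B| + |b - a| * |D| := by rw [abs_mul]; gcongr; exact abs_sub _ _
    _ ≤ 2 * |a| ^ 3 / (k : ℝ) ^ 3 + 2 * |b| ^ 3 / (k : ℝ) ^ 3
        + |b - a| * (2 * 1 ^ 3 / (k : ℝ) ^ 3) := by gcongr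
    _ = _ := by ring

open Filter Topology in
lemma rr_bound (a b : ℝ) (ha : -1 < a) (hb : -1 < b)
    (ha' : ∀ j : ℕ, a - 1 + j ≠ 0) (hb' : ∀ j : ℕ, b - 1 + j ≠ 0) (p : ℕ) (hp0 : p ≠ 0)
    (hp : ∀ k : ℕ, 1 ≤ k → 1 / (k : ℝ) ^ (p + 1) ≤ 2 * (1 / (k : ℝ) ^ p - 1 / ((k : ℝ) + 1) ^ p))
    (K : ℝ) (hK : 0 ≤ K) (N : ℕ) (hN : 1 ≤ N) (hD : ∀ k : ℕ, N ≤ k →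
      |Real.log (rr a b (k + 1)) - Real.log (rr a b k)| ≤ K / (k : ℝ) ^ (p + 1)) :
    ∃ C : ℝ, 0 ≤ C ∧ ∀ k : ℕ, 1 ≤ k → |rr a b k - 1| ≤ C / (k : ℝ) ^ p := by
  have ht := rr_tendsto a b ha' hb'
  have hv : Tendsto (fun k => Real.log (rr a b k)) atTop (𝓝 0) := by
    have := ht.log one_ne_zero
    rwa [Real.log_one] at this
  have hb1 := tail_bound p hp hp0 _ hv K hK N hN hD
  have hev : ∀ᶠ k in atTop, |Real.log (rr a b k)| ≤ 1 := by
    have := hv.abs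
    rw [abs_zero] at this
    exact this.eventually_le_const one_pos
  obtain ⟨M, hM⟩ := eventually_atTop.1 hev
  refine ⟨2 * (2 * K) + ∑ j ∈ Finset.range (max M N), |rr a b j - 1| * (j : ℝ) ^ p,
    by positivity, ?_⟩
  intro k hk
  have hk1 : (1 : ℝ) ≤ k := by exact_mod_cast hk
  have hk0 : (0 : ℝ) < k := by linarith
  rw [le_div_iff₀ (by positivity)]
  rcases le_or_gt (max M N) k with h | h
  · have hpos : 0 < rr a b k := by
      unfold rr
      have := Real.Gamma_pos_of_pos (show 0 < (k : ℝ) + a by linarith)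
      have := Real.Gamma_pos_of_pos (show 0 < (k : ℝ) + b by linarith)
      positivity
    have h1 := Real.abs_exp_sub_one_le (hM k (le_trans (le_max_left _ _) h))
    rw [Real.exp_log hpos] at h1
    have h2 := hb1 k (le_trans (le_max_right _ _) h)
    rw [le_div_iff₀ (by positivity)] at h2
    have h3 : 0 ≤ ∑ j ∈ Finset.range (max M N), |rr a b j - 1| * (j : ℝ) ^ p := by positivity
    have h4 := mul_le_mul_of_nonneg_right h1 (show 0 ≤ (k : ℝ) ^ p by positivity)
    linarith
  · have := Finset.single_le_sum (f := fun j : ℕ => |rr a b j - 1| * (j : ℝ) ^ p)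
      (fun j _ => by positivity) (Finset.mem_range.2 h)
    linarith

lemma rr_bound1 (α : ℝ) (h0 : 0 < α) :
    ∃ C : ℝ, 0 ≤ C ∧ ∀ k : ℕ, 1 ≤ k → |rr (1 / 2) (3 / 2 + α) k - 1| ≤ C / (k : ℝ) := by
  obtain ⟨K, hK, N, hN, h⟩ := step_bound (1 / 2) (3 / 2 + α) (by norm_num) (by linarith)
  set e := (3 / 2 + α - 1 / 2) * (1 / 2 + (3 / 2 + α) - 1) / 2
  have := rr_bound (1 / 2) (3 / 2 + α) (by norm_num) (by linarith) ?_ ?_ 1 one_ne_zero ?_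
    (|e| + K) (by positivity) N hN ?_
  · simpa using this
  · intro j hj
    have : ((2 * j : ℕ) : ℝ) = ((1 : ℕ) : ℝ) := by push_cast; linarith
    have := Nat.cast_injective this
    omega
  · intro j
    have : (0 : ℝ) < 3 / 2 + α - 1 + j := by have : (0 : ℝ) ≤ j := by positivity
                                             linarith
    exact this.ne'
  · intro k hk
    have hk1 : (1 : ℝ) ≤ k := by exact_mod_cast hk
    have hk0 : (0 : ℝ) < k := by linarith
    rw [pow_one, pow_one, div_sub_div _ _ hk0.ne' (by positivity), ← mul_div_assoc,
      div_le_div_iff₀ (by positivity) (by positivity)]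
    ring_nf
    nlinarith
  · intro k hk
    have hk1 : (1 : ℝ) ≤ k := by exact_mod_cast hN.trans hk
    have hk0 : (0 : ℝ) < k := by linarith
    have h1 := h k hk
    have h2 : K / (k : ℝ) ^ 3 ≤ K / (k : ℝ) ^ 2 := by
      gcongr
      · norm_num
    have h3 : |e / (k : ℝ) ^ 2| = |e| / (k : ℝ) ^ 2 := by
      rw [abs_div, abs_of_pos (show (0 : ℝ) < (k : ℝ) ^ 2 by positivity)]
    have h4 := abs_add_le (Real.log (rr (1 / 2) (3 / 2 + α) (k + 1)) -
      Real.log (rr (1 / 2) (3 / 2 + α) k) - e / (k : ℝ) ^ 2) (e / (k : ℝ) ^ 2)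
    rw [sub_add_cancel, h3] at h4
    rw [show 1 + 1 = 2 from rfl, add_div]
    linarith

lemma rr_bound2 (α : ℝ) (h0 : 0 < α) (h2 : α < 2) :
    ∃ C : ℝ, 0 ≤ C ∧ ∀ k : ℕ, 1 ≤ k →
      |rr (-(α / 2)) (α / 2 + 1) k - 1| ≤ C / (k : ℝ) ^ 2 := by
  obtain ⟨K, hK, N, hN, h⟩ := step_bound (-(α / 2)) (α / 2 + 1) (by linarith) (by linarith)
  refine rr_bound (-(α / 2)) (α / 2 + 1) (by linarith) (by linarith) ?_ ?_ 2 two_ne_zero ?_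
    K hK N hN ?_
  · intro j hj
    rcases j with _ | j
    · norm_num at hj; linarith
    · apply ne_half α h0 h2 j
      push_cast at hj
      linarith
  · intro j
    have : (0 : ℝ) < α / 2 + 1 - 1 + j := by have : (0 : ℝ) ≤ j := by positivity
                                             linarith
    exact this.ne'
  · intro k hk
    have hk1 : (1 : ℝ) ≤ k := by exact_mod_cast hk
    have hk0 : (0 : ℝ) < k := by linarith
    have e : 2 * (1 / (k : ℝ) ^ 2 - 1 / ((k : ℝ) + 1) ^ 2) - 1 / (k : ℝ) ^ (2 + 1)
        = (3 * (k : ℝ) ^ 2 - 1) / ((k : ℝ) ^ 3 * ((k : ℝ) + 1) ^ 2) := by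
      field_simp
      ring
    have : 0 ≤ (3 * (k : ℝ) ^ 2 - 1) / ((k : ℝ) ^ 3 * ((k : ℝ) + 1) ^ 2) := by
      apply div_nonneg _ (by positivity)
      nlinarith
    linarith
  · intro k hk
    have h1 := h k hk
    rw [show (-(α / 2) + (α / 2 + 1) - 1) = 0 by ring] at h1
    simpa using h1

/-- Asymptotics of `b_{mn}`: for `n > m` with `m + n` even,
`b_{mn} = θ_α (4/(n²-m²))^{α+1} (1 + O((m+n)^{-1}) + O((n-m)^{-2}))`,
where `θ_α = -sin(πα/2) Γ(α+1) Γ(α/2+1)²/π`. -/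
theorem b_asymptotics (α : ℝ) (hα : α ∈ Set.Ioo (0 : ℝ) 2) :
    ∃ C₁ C₂ : ℝ, ∀ m n : ℕ, m < n → Even (m + n) →
      ∃ e₁ e₂ : ℝ, |e₁| ≤ C₁ / ((m : ℝ) + n) ∧ |e₂| ≤ C₂ / ((n : ℝ) - m) ^ 2 ∧
        (∫ x in (-1 : ℝ)..1,
            (1 - x ^ 2) ^ α * jacobiP (α / 2) (α / 2) m x * jacobiP (α / 2) (α / 2) n x) =
          (-(Real.sin (Real.pi * α / 2) * Real.Gamma (α + 1) *
              Real.Gamma (α / 2 + 1) ^ 2) / Real.pi) *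
            (4 / ((n : ℝ) ^ 2 - (m : ℝ) ^ 2)) ^ (α + 1) * (1 + e₁ + e₂) := by
  obtain ⟨h0, h2⟩ := hα
  obtain ⟨A, hA, h1⟩ := rr_bound1 α h0
  obtain ⟨B, hB, h3⟩ := rr_bound2 α h0 h2
  refine ⟨2 * (A * (1 + B)), 4 * B, ?_⟩
  intro m n hmn hev
  obtain ⟨d, hd1, rfl⟩ : ∃ d, 1 ≤ d ∧ n = m + 2 * d := by
    obtain ⟨r, hr⟩ := hev
    exact ⟨r - m, by omega, by omega⟩
  have hd0 : (0 : ℝ) < d := by exact_mod_cast hd1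
  have hs0 : (0 : ℝ) < (m : ℝ) + d := by positivity
  set R1 := rr (1 / 2) (3 / 2 + α) (m + d) with hR1
  set R2 := rr (-(α / 2)) (α / 2 + 1) d with hR2
  have b1 := h1 (m + d) (by omega)
  have b2 := h3 d hd1
  rw [← hR1] at b1
  rw [← hR2] at b2
  push_cast at b1
  have hR2b : |R2| ≤ 1 + B := by
    have hd1' : (1 : ℝ) ≤ (d : ℝ) ^ 2 := one_le_pow₀ (by exact_mod_cast hd1)
    have : B / (d : ℝ) ^ 2 ≤ B := div_le_self hB hd1'
    have h4 := abs_add_le (R2 - 1) 1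
    rw [sub_add_cancel, abs_one] at h4
    linarith
  refine ⟨(R1 - 1) * R2, R2 - 1, ?_, ?_, ?_⟩
  · rw [abs_mul]
    calc |R1 - 1| * |R2| ≤ A / ((m : ℝ) + d) * (1 + B) := by gcongr
      _ = _ := by push_cast; field_simp; ring
  · refine b2.trans (le_of_eq ?_)
    push_cast
    rw [show (m : ℝ) + 2 * d - m = 2 * d by ring]
    field_simp
    ring
  · have hc := (closed_form α h0 h2 m).1 d
    change bI α m (m + 2 * d) = th α * _ * _
    rw [hc]
    have e1 : 4 / (((m + 2 * d : ℕ) : ℝ) ^ 2 - (m : ℝ) ^ 2) = (((m : ℝ) + d) * d)⁻¹ := by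
      push_cast
      rw [show ((m : ℝ) + 2 * d) ^ 2 - (m : ℝ) ^ 2 = 4 * ((m + d) * d) by ring]
      field_simp
    have q1 : R1 = gs α (m + d) * ((m : ℝ) + d) ^ (α + 1) := by
      rw [hR1]
      unfold rr gs
      push_cast
      rw [show 3 / 2 + α - 1 / 2 = α + 1 by ring]
    have q2 : R2 = hd α d * (d : ℝ) ^ (α + 1) := by
      rw [hR2]
      unfold rr hd
      rw [show α / 2 + 1 - -(α / 2) = α + 1 by ring]
    rw [e1, Real.inv_rpow (by positivity), Real.mul_rpow hs0.le hd0.le,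
      show 1 + (R1 - 1) * R2 + (R2 - 1) = R1 * R2 by ring, q1, q2]
    have := Real.rpow_pos_of_pos hs0 (α + 1)
    have := Real.rpow_pos_of_pos hd0 (α + 1)
    field_simp
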